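/- For all integers g, h ≥ 1 and every n ≥ 1, the statistic g den_h is equidistributed with inv over S_n; that is, for every integer b, the number of σ ∈ S_n with g den_h(σ) = b equals the number of σ ∈ S_n with inv(σ) = b. (g den_h is Mahonian.) -/

import Mathlib

open Finset

namespace PaperStmt

/-- 1-based position of `i : Fin n` (so positions run through `1,…,n`). -/
def pos1 {n : ℕ} (i : Fin n) : ℕ := (i : ℕ) + 1

/-- 1-based value `σ_i` of the permutation `σ` at position `i`. -/
def val1 {n : ℕ} (σ : Equiv.Perm (Fin n)) (i : Fin n) : ℕ := (σ i : ℕ) + 1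

/-- The number of inversions of the subsequence of `σ` consisting of the letters at the
positions satisfying `P`: pairs of positions `i < j`, both satisfying `P`,
with `σ_i > σ_j`. -/
def invOn {n : ℕ} (σ : Equiv.Perm (Fin n)) (P : Fin n → Prop) [DecidablePred P] : ℕ :=
  (univ.filter fun p : Fin n × Fin n =>
    p.1 < p.2 ∧ P p.1 ∧ P p.2 ∧ val1 σ p.2 < val1 σ p.1).card

/-- `inv σ`: the number of inversions of `σ`. -/
def inv {n : ℕ} (σ : Equiv.Perm (Fin n)) : ℕ := invOn σ (fun _ => True)

/-- `Exc(σ)`: the set of excedances, i.e. positions `i` with `σ_i > i`. -/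
def excSet {n : ℕ} (σ : Equiv.Perm (Fin n)) : Finset (Fin n) :=
  univ.filter fun i => pos1 i < val1 σ i

/-- `exc σ`: the number of excedances. -/
def exc {n : ℕ} (σ : Equiv.Perm (Fin n)) : ℕ := (excSet σ).card

/-- `exc_r(σ)`: the number of `r`-level excedances, i.e. positions `i ≥ r` with `σ_i > i`. -/
def excLvl {n : ℕ} (r : ℕ) (σ : Equiv.Perm (Fin n)) : ℕ :=
  (univ.filter fun i => pos1 i < val1 σ i ∧ r ≤ pos1 i).card

/-- Denert's statistic `den σ`. -/
def den {n : ℕ} (σ : Equiv.Perm (Fin n)) : ℕ :=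
  ((univ.filter fun i => pos1 i < val1 σ i).sum pos1)
  + invOn σ (fun i => pos1 i < val1 σ i)
  + invOn σ (fun i => ¬ pos1 i < val1 σ i)

/-- The `h`-level Denert statistic `den_h(σ)`. -/
def denLvl {n : ℕ} (h : ℕ) (σ : Equiv.Perm (Fin n)) : ℕ :=
  ((univ.filter fun i => pos1 i < val1 σ i ∧ h ≤ val1 σ i).sum pos1)
  + invOn σ (fun i => pos1 i < val1 σ i ∧ h ≤ val1 σ i)
  + invOn σ (fun i => ¬ (pos1 i < val1 σ i ∧ h ≤ val1 σ i))

/-- `g exc_ℓ(σ)`: the number of `g`-gap `ℓ`-level excedances,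
i.e. positions `i ≥ ℓ` with `σ_i ≥ i + g`. -/
def gexc {n : ℕ} (g l : ℕ) (σ : Equiv.Perm (Fin n)) : ℕ :=
  (univ.filter fun i => pos1 i + g ≤ val1 σ i ∧ l ≤ pos1 i).card

/-- `gExclp_h(σ)`: the set of `g`-gap `h`-level excedance-letter positions,
i.e. positions `i` with `σ_i ≥ i + g` and `σ_i ≥ h`. -/
def gExclpSet {n : ℕ} (g h : ℕ) (σ : Equiv.Perm (Fin n)) : Finset (Fin n) :=
  univ.filter fun i => pos1 i + g ≤ val1 σ i ∧ h ≤ val1 σ i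

/-- The `g`-gap `h`-level Denert statistic `g den_h(σ)`. -/
def gden {n : ℕ} (g h : ℕ) (σ : Equiv.Perm (Fin n)) : ℕ :=
  ((univ.filter fun i => pos1 i + g ≤ val1 σ i ∧ h ≤ val1 σ i).sum fun i => pos1 i + g - 1)
  + invOn σ (fun i => pos1 i + g ≤ val1 σ i ∧ h ≤ val1 σ i)
  + invOn σ (fun i => ¬ (pos1 i + g ≤ val1 σ i ∧ h ≤ val1 σ i))

/-- `rexc σ`: the number of `r`-excedances, i.e. positions `i` with `σ_i ≥ i + r`. -/
def rexc {n : ℕ} (r : ℕ) (σ : Equiv.Perm (Fin n)) : ℕ :=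
  (univ.filter fun i => pos1 i + r ≤ val1 σ i).card

/-- The `r`-Denert statistic `rden σ`. -/
def rden {n : ℕ} (r : ℕ) (σ : Equiv.Perm (Fin n)) : ℕ :=
  ((univ.filter fun i => pos1 i + r ≤ val1 σ i).sum fun i => pos1 i + r - 1)
  + invOn σ (fun i => pos1 i + r ≤ val1 σ i)
  + invOn σ (fun i => ¬ pos1 i + r ≤ val1 σ i)

/-- Pairs `(i, i+1)` of adjacent positions forming an `r`-descent: `σ_i ≥ σ_{i+1} + r`. -/
def rdesPairs {n : ℕ} (r : ℕ) (σ : Equiv.Perm (Fin n)) : Finset (Fin n × Fin n) :=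
  univ.filter fun p => pos1 p.2 = pos1 p.1 + 1 ∧ val1 σ p.2 + r ≤ val1 σ p.1

/-- `rdes σ`: the number of `r`-descents. -/
def rdes {n : ℕ} (r : ℕ) (σ : Equiv.Perm (Fin n)) : ℕ := (rdesPairs r σ).card

/-- `rmaj σ`: the sum of the `r`-descents plus the number of pairs `i < j`
with `σ_j < σ_i < σ_j + r`. -/
def rmaj {n : ℕ} (r : ℕ) (σ : Equiv.Perm (Fin n)) : ℕ :=
  ((rdesPairs r σ).sum fun p => pos1 p.1)
  + (univ.filter fun p : Fin n × Fin n =>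
      p.1 < p.2 ∧ val1 σ p.2 < val1 σ p.1 ∧ val1 σ p.1 < val1 σ p.2 + r).card

/-- `des σ`: the number of descents, i.e. positions `i ∈ [n-1]` with `σ_i > σ_{i+1}`. -/
def des {n : ℕ} (σ : Equiv.Perm (Fin n)) : ℕ :=
  (univ.filter fun p : Fin n × Fin n =>
    pos1 p.2 = pos1 p.1 + 1 ∧ val1 σ p.2 < val1 σ p.1).card

/-- `maj σ`: the major index, i.e. the sum of the descents of `σ`. -/
def maj {n : ℕ} (σ : Equiv.Perm (Fin n)) : ℕ :=
  ((univ.filter fun p : Fin n × Fin n =>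
    pos1 p.2 = pos1 p.1 + 1 ∧ val1 σ p.2 < val1 σ p.1).sum fun p => pos1 p.1)

/-- The number of `i < j` such that `σ i` precedes `σ j` in the order on letters induced by the
keys `key j`. -/
def keyCode {n : ℕ} (key : Fin n → Fin n → ℕ) (σ : Equiv.Perm (Fin n)) (j : Fin n) : ℕ :=
  (univ.filter fun i => i < j ∧ key j (σ i) < key j (σ j)).card

theorem keyCode_lt {n : ℕ} (key : Fin n → Fin n → ℕ) (σ : Equiv.Perm (Fin n)) (j : Fin n) :
    keyCode key σ j < j + 1 := by
  have h : keyCode key σ j ≤ (Finset.Iio j).card :=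
    Finset.card_le_card fun i hi => by simp at hi ⊢; exact hi.1
  rw [Fin.card_Iio] at h
  omega

theorem keyCode_injective {n : ℕ} {key : Fin n → Fin n → ℕ}
    (hkey : ∀ j, Function.Injective (key j)) :
    Function.Injective (keyCode key) := by
  intro σ τ hst
  have hrank : ∀ (ρ : Equiv.Perm (Fin n)) (j : Fin n), keyCode key ρ j =
      (((univ.filter fun i => j < i).image ρ)ᶜ.filter fun w => key j w < key j (ρ j)).card := by
    intro ρ j
    unfold keyCode
    rw [← Finset.card_image_of_injective _ ρ.injective]
    congr 1
    ext w
    obtain ⟨i, rfl⟩ := ρ.surjective w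
    simp only [mem_image, mem_filter, mem_univ, true_and, mem_compl, EmbeddingLike.apply_eq_iff_eq,
      exists_eq_right, not_lt]
    constructor
    · rintro ⟨h1, h2⟩
      exact ⟨h1.le, h2⟩
    · rintro ⟨h1, h2⟩
      refine ⟨lt_of_le_of_ne h1 ?_, h2⟩
      rintro rfl
      exact lt_irrefl _ h2
  have hmono : ∀ (V : Finset (Fin n)) (j a b : Fin n), a ∈ V → key j a < key j b →
      (V.filter fun w => key j w < key j a).card < (V.filter fun w => key j w < key j b).card := by
    intro V j a b ha hab
    apply Finset.card_lt_card
    rw [Finset.ssubset_iff_of_subset]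
    · exact ⟨a, by simp [ha, hab], by simp⟩
    · intro w hw
      simp only [mem_filter] at hw ⊢
      exact ⟨hw.1, hw.2.trans hab⟩
  have hagree : ∀ m : ℕ, ∀ j : Fin n, n - (j : ℕ) = m → σ j = τ j := by
    intro m
    induction m using Nat.strong_induction_on with
    | _ m ih =>
      intro j hj
      have hlater : ∀ k, j < k → σ k = τ k := fun k hk =>
        ih (n - k) (by have := k.isLt; have : (j : ℕ) < k := hk; omega) k rfl
      have himg : (univ.filter fun i => j < i).image σ = (univ.filter fun i => j < i).image τ :=
        Finset.image_congr fun i hi => hlater i (by simpa using hi)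
      have hmem : ∀ ρ : Equiv.Perm (Fin n), ρ j ∈ ((univ.filter fun i => j < i).image ρ)ᶜ := by
        intro ρ; simp
      have heq := congrFun hst j
      rw [hrank, hrank, himg] at heq
      have hσ := hmem σ
      rw [himg] at hσ
      rcases lt_trichotomy (key j (σ j)) (key j (τ j)) with h | h | h
      · exact absurd heq (hmono _ j _ _ hσ h).ne
      · exact hkey j h
      · exact absurd heq (hmono _ j _ _ (hmem τ) h).ne'
  exact Equiv.ext fun j => hagree _ j rfl

/-- The sum of a key code is distributed as the sum of the entries of a subexcedant sequence. -/
theorem card_sum_keyCode_eq {n : ℕ} {key : Fin n → Fin n → ℕ}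
    (hkey : ∀ j, Function.Injective (key j)) (b : ℕ) :
    ((univ : Finset (Equiv.Perm (Fin n))).filter fun σ => ∑ j, keyCode key σ j = b).card =
      ((univ : Finset (∀ j : Fin n, Fin (j + 1))).filter fun f => ∑ j, (f j : ℕ) = b).card := by
  let F : Equiv.Perm (Fin n) → ∀ j : Fin n, Fin (j + 1) :=
    fun σ j => ⟨keyCode key σ j, keyCode_lt key σ j⟩
  have hF : Function.Injective F := fun σ τ h => keyCode_injective hkey <|
    funext fun j => congrArg Fin.val (congrFun h j)
  have hbij : Function.Bijective F := by
    rw [Fintype.bijective_iff_injective_and_card]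
    refine ⟨hF, ?_⟩
    rw [Fintype.card_perm, Fintype.card_pi, Fintype.card_fin]
    simp only [Fintype.card_fin]
    rw [Fin.prod_univ_eq_prod_range (fun i => i + 1) n, Finset.prod_range_add_one_eq_factorial]
  refine Finset.card_bijective F hbij fun σ => ?_
  simp [F]

theorem invOn_eq_sum {n : ℕ} (σ : Equiv.Perm (Fin n)) (P : Fin n → Prop) [DecidablePred P] :
    invOn σ P = ∑ j, ∑ i, if i < j ∧ P i ∧ P j ∧ σ j < σ i then 1 else 0 := by
  unfold invOn
  rw [Finset.card_filter, Fintype.sum_prod_type_right]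
  simp [val1]

theorem inv_eq_sum_keyCode {n : ℕ} (σ : Equiv.Perm (Fin n)) :
    inv σ = ∑ j, keyCode (fun _ v => n - (v : ℕ)) σ j := by
  unfold inv keyCode
  rw [invOn_eq_sum]
  refine Finset.sum_congr rfl fun j _ => ?_
  rw [Finset.card_filter]
  refine Finset.sum_congr rfl fun i _ => ?_
  have := (σ i).isLt
  have := (σ j).isLt
  have h : (i < j ∧ True ∧ True ∧ σ j < σ i) ↔ (i < j ∧ n - (σ i : ℕ) < n - (σ j : ℕ)) := by
    simp only [Fin.lt_def, true_and]
    omega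
  simp only [h]

/-- `v` (a letter counted from `0`) is large enough to be a `g`-gap `h`-level excedance letter at
position `j`. -/
def IsExcl {n : ℕ} (g h : ℕ) (j v : Fin n) : Prop :=
  (j : ℕ) + g ≤ v ∧ h ≤ (v : ℕ) + 1

instance {n : ℕ} (g h : ℕ) (j v : Fin n) : Decidable (IsExcl g h j v) :=
  inferInstanceAs (Decidable (_ ∧ _))

/-- The cyclic order of letters attached to position `j`: first the letters that are not
excedance letters at `j`, then the others, decreasingly within both blocks. -/
def gdenKey {n : ℕ} (g h : ℕ) (j v : Fin n) : ℕ :=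
  if IsExcl g h j v then 2 * n - v else n - v

theorem gdenKey_lt_iff {n : ℕ} (g h : ℕ) (j v w : Fin n) :
    gdenKey g h j v < gdenKey g h j w ↔
      IsExcl g h j w ∧ ¬ IsExcl g h j v ∨ (¬ IsExcl g h j v ∨ IsExcl g h j w) ∧ w < v := by
  have := v.isLt
  have := w.isLt
  rw [Fin.lt_def]
  unfold gdenKey
  by_cases hv : IsExcl g h j v <;> by_cases hw : IsExcl g h j w <;> simp [hv, hw] <;> omega

theorem gdenKey_injective {n : ℕ} (g h : ℕ) (j : Fin n) :
    Function.Injective (gdenKey g h j) := by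
  intro v w hvw
  have := v.isLt
  have := w.isLt
  unfold gdenKey at hvw
  ext
  by_cases hv : IsExcl g h j v <;> by_cases hw : IsExcl g h j w <;> simp [hv, hw] at hvw <;> omega

/-- Around the letter at an excedance position `a`: smaller letters sitting beyond its gap
outnumber by `g` the larger letters sitting before it. -/
theorem card_smaller_late_eq {n : ℕ} (g : ℕ) (σ : Equiv.Perm (Fin n)) (a : Fin n)
    (ha : (a : ℕ) + g ≤ σ a) :
    (∑ k : Fin n, if (σ a : ℕ) < k + g ∧ σ k < σ a then 1 else 0) =
      g + ∑ k : Fin n, if (k : ℕ) + g ≤ σ a ∧ σ a < σ k then 1 else 0 := by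
  have hlt := (σ a).isLt
  have hA : (∑ k : Fin n, if (σ a : ℕ) < k + g then 1 else 0) = n - 1 - (σ a) + g := by
    rw [← Finset.card_filter]
    have hc : (univ.filter fun k : Fin n => (σ a : ℕ) < k + g) =
        Finset.Ioi ⟨σ a - g, by omega⟩ := by
      ext k
      simp only [mem_filter, mem_univ, true_and, mem_Ioi, Fin.lt_def]
      omega
    rw [hc, Fin.card_Ioi]
    simp only
    omega
  have hB : (∑ k : Fin n, if σ a < σ k then 1 else 0) = n - 1 - (σ a) := by
    rw [Equiv.sum_comp σ (fun w => if σ a < w then 1 else 0), ← Finset.card_filter]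
    have hc : (univ.filter fun w : Fin n => σ a < w) = Finset.Ioi (σ a) := by
      ext w; simp
    rw [hc, Fin.card_Ioi]
  have hC : (∑ k : Fin n, if (σ a : ℕ) < k + g ∧ σ k < σ a then 1 else 0) +
      (∑ k : Fin n, if σ a < σ k then 1 else 0) =
      (∑ k : Fin n, if (σ a : ℕ) < k + g then 1 else 0) +
      ∑ k : Fin n, if (k : ℕ) + g ≤ σ a ∧ σ a < σ k then 1 else 0 := by
    rw [← Finset.sum_add_distrib, ← Finset.sum_add_distrib]
    refine Finset.sum_congr rfl fun k _ => ?_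
    have hk : σ k = σ a → k = a := fun h => σ.injective h
    rcases lt_trichotomy (σ k) (σ a) with h | h | h
    · simp [h, h.not_gt]
    · have := hk h
      subst this
      simp
      omega
    · by_cases h' : (σ a : ℕ) < k + g
      · simp [h, h', h.not_gt]
      · simp [h, h', h.not_gt]
  omega

/-- Double counting of nestings and `g`-gap crossings of excedances. -/
theorem sum_nesting_add_crossing {n : ℕ} (g h : ℕ) (σ : Equiv.Perm (Fin n)) :
    (∑ a, ∑ k : Fin n, if IsExcl g h a (σ a) ∧ (k : ℕ) + g ≤ σ a ∧ σ a < σ k then 1 else 0) =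
      ∑ j, ∑ i, if i < j ∧ IsExcl g h j (σ j) ∧ IsExcl g h j (σ i) then 1 else 0 := by
  have h1 : (∑ a, ∑ k : Fin n,
      if IsExcl g h a (σ a) ∧ (k : ℕ) + g ≤ σ a ∧ σ a < σ k then 1 else 0) =
      (∑ j, ∑ i, if i < j ∧ IsExcl g h j (σ j) ∧ σ j < σ i then 1 else 0) +
      ∑ i, ∑ j, if i < j ∧ IsExcl g h j (σ i) ∧ σ i < σ j then 1 else 0 := by
    rw [← Finset.sum_add_distrib]
    refine Finset.sum_congr rfl fun a _ => ?_
    rw [← Finset.sum_add_distrib]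
    refine Finset.sum_congr rfl fun k _ => ?_
    rcases lt_trichotomy k a with hk | rfl | hk <;> grind [IsExcl]
  have h2 : (∑ j, ∑ i, if i < j ∧ IsExcl g h j (σ j) ∧ IsExcl g h j (σ i) then 1 else 0) =
      (∑ j, ∑ i, if i < j ∧ IsExcl g h j (σ j) ∧ σ j < σ i then 1 else 0) +
      ∑ j, ∑ i, if i < j ∧ IsExcl g h j (σ i) ∧ σ i < σ j then 1 else 0 := by
    rw [← Finset.sum_add_distrib]
    refine Finset.sum_congr rfl fun j _ => ?_
    rw [← Finset.sum_add_distrib]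
    refine Finset.sum_congr rfl fun i _ => ?_
    have hij : σ i = σ j → i = j := fun h => σ.injective h
    rcases lt_trichotomy (σ i) (σ j) with hk | hk | hk <;> grind [IsExcl]
  rw [h1, h2]
  congr 1
  exact Finset.sum_comm

theorem gden_eq_sum_keyCode {n : ℕ} (g h : ℕ) (σ : Equiv.Perm (Fin n)) :
    gden g h σ = ∑ j, keyCode (gdenKey g h) σ j := by
  have hE : ∀ i, (pos1 i + g ≤ val1 σ i ∧ h ≤ val1 σ i) ↔ IsExcl g h i (σ i) := by
    intro i
    unfold pos1 val1 IsExcl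
    omega
  have hpos : ((univ.filter fun i => pos1 i + g ≤ val1 σ i ∧ h ≤ val1 σ i).sum
      fun i => pos1 i + g - 1) =
      (∑ a, if IsExcl g h a (σ a) then g else 0) +
        ∑ j, ∑ i, if i < j ∧ IsExcl g h j (σ j) then 1 else 0 := by
    rw [Finset.sum_filter, ← Finset.sum_add_distrib]
    refine Finset.sum_congr rfl fun j _ => ?_
    rw [if_congr (hE j) rfl rfl]
    by_cases hj : IsExcl g h j (σ j)
    · simp only [hj, if_true, and_true]
      rw [← Finset.card_filter]
      have hc : (univ.filter fun i : Fin n => i < j) = Finset.Iio j := by ext; simp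
      rw [hc, Fin.card_Iio]
      unfold pos1
      omega
    · simp [hj]
  have hgap : (∑ a, ∑ k : Fin n,
      if IsExcl g h a (σ a) ∧ (σ a : ℕ) < k + g ∧ σ k < σ a then 1 else 0) =
      (∑ a, if IsExcl g h a (σ a) then g else 0) +
      ∑ a, ∑ k : Fin n, if IsExcl g h a (σ a) ∧ (k : ℕ) + g ≤ σ a ∧ σ a < σ k then 1 else 0 := by
    rw [← Finset.sum_add_distrib]
    refine Finset.sum_congr rfl fun a _ => ?_
    by_cases ha : IsExcl g h a (σ a)
    · simpa only [ha, true_and, if_true] using card_smaller_late_eq g σ a ha.1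
    · simp [ha]
  rw [sum_nesting_add_crossing, Finset.sum_comm] at hgap
  have hmain : (∑ j, keyCode (gdenKey g h) σ j) +
      (∑ j, ∑ i, if i < j ∧ IsExcl g h j (σ j) ∧ IsExcl g h j (σ i) then 1 else 0) =
      invOn σ (fun i => pos1 i + g ≤ val1 σ i ∧ h ≤ val1 σ i) +
      invOn σ (fun i => ¬ (pos1 i + g ≤ val1 σ i ∧ h ≤ val1 σ i)) +
      (∑ j : Fin n, ∑ i, if IsExcl g h i (σ i) ∧ (σ i : ℕ) < j + g ∧ σ j < σ i then 1 else 0) +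
      ∑ j, ∑ i, if i < j ∧ IsExcl g h j (σ j) then 1 else 0 := by
    simp only [invOn_eq_sum, hE, ← Finset.sum_add_distrib]
    refine Finset.sum_congr rfl fun j _ => ?_
    unfold keyCode
    rw [Finset.card_filter]
    simp only [← Finset.sum_add_distrib]
    refine Finset.sum_congr rfl fun i _ => ?_
    simp only [gdenKey_lt_iff, IsExcl, Fin.lt_def]
    by_cases hij : (i : ℕ) < j <;> by_cases hlt : (σ j : ℕ) < σ i <;>
      by_cases hw : h ≤ (σ j : ℕ) + 1 <;> by_cases hv : h ≤ (σ i : ℕ) + 1 <;>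
      simp only [hij, hlt, hw, hv, true_and, and_true, false_and, and_false, not_false_eq_true,
        true_or, or_true, or_false, false_or, if_false] <;>
      split_ifs <;> omega
  unfold gden
  rw [hpos]
  omega

/-- `g den_h` is Mahonian: it is equidistributed with `inv` over `S_n`. -/
theorem gden_is_mahonian (g h n : ℕ) (hg : 1 ≤ g) (hh : 1 ≤ h) (hn : 1 ≤ n) (b : ℕ) :
    ((univ : Finset (Equiv.Perm (Fin n))).filter fun σ => gden g h σ = b).card
      = ((univ : Finset (Equiv.Perm (Fin n))).filter fun σ => inv σ = b).card := by
  simp only [gden_eq_sum_keyCode, inv_eq_sum_keyCode]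
  rw [card_sum_keyCode_eq (gdenKey_injective g h), card_sum_keyCode_eq]
  intro _ v w hvw
  have := v.isLt
  have := w.isLt
  ext
  simp only at hvw
  omega

end PaperStmt
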